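/- If N₁ and N₂ are extremal sets of natural numbers and their intersection N₁ ∩ N₂ has positive density, then N₁ ∩ N₂ is extremal. -/

import Mathlib

open MeasureTheory Filter Finset
open scoped Classical

/-- `e t = exp(2πit)`. -/
noncomputable def e (t : ℝ) : ℂ := Complex.exp (2 * Real.pi * Complex.I * t)

/-- `N` has (natural) density `ρ`. -/
def HasDensity (N : Set ℕ) (ρ : ℝ) : Prop :=
  Filter.Tendsto (fun x : ℕ => (((Finset.Icc 1 x).filter (fun n => n ∈ N)).card : ℝ) / x)
    Filter.atTop (nhds ρ)

/-- `N` has density `d` in the residue class `a` modulo `q`. -/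
def HasResidueDensity (N : Set ℕ) (q a : ℕ) (d : ℝ) : Prop :=
  Filter.Tendsto (fun x : ℕ =>
      (((Finset.Icc 1 x).filter (fun n => n ∈ N ∧ n % q = a % q)).card : ℝ) / x)
    Filter.atTop (nhds d)

/-- `N` is distributed: all residue class densities exist. -/
def Distributed (N : Set ℕ) : Prop := ∀ q, 1 ≤ q → ∀ a, ∃ d, HasResidueDensity N q a d

/-- The singular series `∑_{q≥1} ∑_{(a,q)=1} |∑_{b=1}^q (F(q,b)/ρ) e(ab/q)|²`. -/
noncomputable def extremalSum (F : ℕ → ℕ → ℝ) (ρ : ℝ) : ℝ :=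
  ∑' q : ℕ, ∑ a ∈ (Finset.Icc 1 q).filter (fun a => Nat.Coprime a q),
    ‖∑ b ∈ Finset.Icc 1 q, ((F q b / ρ : ℝ) : ℂ) * e (((a : ℝ) * b) / q)‖ ^ 2

/-- `N` is extremal. -/
def Extremal (N : Set ℕ) : Prop :=
  ∃ ρ : ℝ, 0 < ρ ∧ HasDensity N ρ ∧
    ∃ F : ℕ → ℕ → ℝ, (∀ q, 1 ≤ q → ∀ a, HasResidueDensity N q a (F q a)) ∧
      1 / ρ = extremalSum F ρ

/-- `S(θ) = ∑_{n ≤ x, n ∈ N} e(θn)`. -/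
noncomputable def expSum (N : Set ℕ) (x : ℕ) (θ : ℝ) : ℂ :=
  ∑ n ∈ (Finset.Icc 1 x).filter (fun n => n ∈ N), e (θ * n)

/-- Rational major arcs `M(x,Q)`. -/
def majorArcs (x Q : ℕ) : Set ℝ :=
  ⋃ q ∈ Finset.Icc 1 Q, ⋃ a ∈ (Finset.Icc 1 q).filter (fun a => Nat.Coprime a q),
    Set.Icc ((a : ℝ) / q - Q / x) ((a : ℝ) / q + Q / x)

/-- Rational minor arcs `m(x,Q) = [0,1] \ M(x,Q)`. -/
def minorArcs (x Q : ℕ) : Set ℝ := Set.Icc 0 1 \ majorArcs x Q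

/-- Characteristic function of a set of naturals. -/
noncomputable def charFun (N : Set ℕ) : ℕ → ℂ := fun n => if n ∈ N then 1 else 0

/-- A (nonconstant-period) periodic function on `ℕ`. -/
def IsPeriodicFn (g : ℕ → ℂ) : Prop := ∃ p : ℕ, 1 ≤ p ∧ ∀ n, g (n + p) = g n

/-- Trigonometric polynomials `n ↦ ∑ a_ν e(α_ν n)`. -/
def IsTrigPoly (g : ℕ → ℂ) : Prop :=
  ∃ (k : ℕ) (a : Fin k → ℂ) (α : Fin k → ℝ), ∀ n : ℕ, g n = ∑ ν : Fin k, a ν * e (α ν * n)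

/-- The seminorm `‖f‖₂ = (limsup_x (1/x) ∑_{n≤x} |f n|²)^{1/2}`. -/
noncomputable def seminorm2 (f : ℕ → ℂ) : ℝ :=
  Real.sqrt (Filter.limsup (fun x : ℕ => (∑ n ∈ Finset.Icc 1 x, ‖f n‖ ^ 2) / x) Filter.atTop)

/-- `f` lies in `A²`, the `‖·‖₂`-closure of the trigonometric polynomials. -/
def MemA2 (f : ℕ → ℂ) : Prop :=
  ∀ ε : ℝ, 0 < ε → ∃ g : ℕ → ℂ, IsTrigPoly g ∧ seminorm2 (fun n => f n - g n) < ε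

/-- `f` lies in `B²`, the `‖·‖₂`-closure of the periodic functions. -/
def MemB2 (f : ℕ → ℂ) : Prop :=
  ∀ ε : ℝ, 0 < ε → ∃ g : ℕ → ℂ, IsPeriodicFn g ∧ seminorm2 (fun n => f n - g n) < ε

/-- `f` is `B²`-almost periodic: there is a sequence of periodic functions `fq` with
`limsup_x (1/x) ∑_{n≤x} |f n - fq n|² → 0`. -/
def B2AlmostPeriodic (f : ℕ → ℂ) : Prop :=
  ∃ fq : ℕ → ℕ → ℂ, (∀ q, IsPeriodicFn (fq q)) ∧
    Filter.Tendsto (fun q : ℕ =>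
        Filter.limsup (fun x : ℕ => (∑ n ∈ Finset.Icc 1 x, ‖f n - fq q n‖ ^ 2) / x)
          Filter.atTop)
      Filter.atTop (nhds 0)

/-- The Fourier coefficient `⟨f, e_β⟩ = lim_x (1/x) ∑_{n≤x} f n e(-βn)` equals `c`. -/
def HasFourierCoeff (f : ℕ → ℂ) (β : ℝ) (c : ℂ) : Prop :=
  Filter.Tendsto (fun x : ℕ => (∑ n ∈ Finset.Icc 1 x, f n * e (-(β * n))) / (x : ℂ))
    Filter.atTop (nhds c)

/-- The spectrum of `f`: those `β` with nonzero Fourier coefficient. -/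
def spec (f : ℕ → ℂ) : Set ℝ := {β | ∃ c : ℂ, c ≠ 0 ∧ HasFourierCoeff f β c}

/-- Major arcs `M_α(x,Q)` relative to a sequence `α`. -/
def majorArcsAlpha (α : ℕ → ℝ) (x Q : ℕ) : Set ℝ :=
  ⋃ n : ℕ, ⋃ _ : n ≤ Q, Set.Icc (α n - Q / x) (α n + Q / x)

/-- Minor arcs `m_α(x,Q) = [0,1] \ M_α(x,Q)`. -/
def minorArcsAlpha (α : ℕ → ℝ) (x Q : ℕ) : Set ℝ := Set.Icc 0 1 \ majorArcsAlpha α x Q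

/-- `N` is `α`-extremal: it has positive density, all Fourier coefficients of its
characteristic function exist, and `∫_{m_α(x,Q(x))} |S|² = o(x)` for every `Q(x) → ∞`. -/
def AlphaExtremal (N : Set ℕ) (α : ℕ → ℝ) : Prop :=
  (∃ ρ : ℝ, 0 < ρ ∧ HasDensity N ρ) ∧
  (∀ β : ℝ, ∃ c : ℂ, HasFourierCoeff (charFun N) β c) ∧
  ∀ Q : ℕ → ℕ, Filter.Tendsto Q Filter.atTop Filter.atTop →
    Filter.Tendsto (fun x : ℕ =>
        (∫ θ in minorArcsAlpha α x (Q x), ‖expSum N x θ‖ ^ 2) / x)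
      Filter.atTop (nhds 0)

/-- The class of `b` modulo `Q` has density `1 / Q`. -/
theorem hasResidueDensity_univ {Q : ℕ} (hQ : 1 ≤ Q) (b : ℕ) :
    HasResidueDensity Set.univ Q b (1 / Q) := by
  have hQ0 : (0 : ℝ) < Q := by exact_mod_cast hQ
  have key : ∀ x : ℕ,
      |(((Finset.Icc 1 x).filter (fun n => n ∈ Set.univ ∧ n % Q = b % Q)).card : ℝ) - x / Q| ≤ 1 := by
    intro x
    have h := Nat.Ioc_filter_modEq_card (a := 0) (b := x) hQ b
    have hs : (Finset.Icc 1 x).filter (fun n => n ∈ Set.univ ∧ n % Q = b % Q)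
        = {n ∈ Finset.Ioc 0 x | n ≡ b [MOD Q]} := by
      ext n
      simp only [Finset.mem_filter, Finset.mem_Icc, Finset.mem_Ioc, Set.mem_univ, true_and]
      exact Iff.rfl
    rw [hs]
    have h' : (({n ∈ Finset.Ioc 0 x | n ≡ b [MOD Q]}.card : ℤ)) =
        max (⌊((x : ℚ) - b) / Q⌋ - ⌊(((0 : ℕ) : ℚ) - b) / Q⌋) 0 := by
      convert h using 3
    set c := ({n ∈ Finset.Ioc 0 x | n ≡ b [MOD Q]}.card : ℕ)
    have hQq : (0 : ℚ) < Q := by exact_mod_cast hQ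
    have hle : (((0 : ℕ) : ℚ) - b) / Q ≤ ((x : ℚ) - b) / Q := by
      gcongr; simp
    have hfl := Int.floor_le_floor hle
    rw [max_eq_left (by omega)] at h'
    have e1 := Int.floor_le (((x : ℚ) - b) / Q)
    have e2 := Int.lt_floor_add_one (((x : ℚ) - b) / Q)
    have e3 := Int.floor_le ((((0 : ℕ) : ℚ) - b) / Q)
    have e4 := Int.lt_floor_add_one ((((0 : ℕ) : ℚ) - b) / Q)
    have h'' : (c : ℚ) = (⌊((x : ℚ) - b) / Q⌋ : ℚ) - ⌊(((0 : ℕ) : ℚ) - b) / Q⌋ := by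
      exact_mod_cast h'
    have e5 : ((x : ℚ) - b) / Q - (((0 : ℕ) : ℚ) - b) / Q = x / Q := by
      push_cast; ring
    have : |(c : ℚ) - x / Q| ≤ 1 := by
      rw [abs_le]; constructor <;> linarith
    have h6 : (((|(c : ℚ) - x / Q| : ℚ)) : ℝ) ≤ ((1 : ℚ) : ℝ) := Rat.cast_le.2 this
    push_cast at h6
    exact h6
  unfold HasResidueDensity
  rw [tendsto_iff_norm_sub_tendsto_zero]
  refine squeeze_zero' (Eventually.of_forall fun _ => norm_nonneg _) ?_
    tendsto_one_div_atTop_nhds_zero_nat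
  filter_upwards [eventually_gt_atTop 0] with x hx
  have hx0 : (0 : ℝ) < x := by exact_mod_cast hx
  have : ∀ c : ℝ, c / x - 1 / Q = (c - x / Q) / x := fun c => by field_simp
  rw [this, Real.norm_eq_abs, abs_div, abs_of_pos hx0]
  refine le_of_eq_of_le ?_ (div_le_div_of_nonneg_right (key x) hx0.le)
  congr!

/-- Means over `N` of a function periodic modulo `Q` are determined by the densities of `N` in the
residue classes modulo `Q`. -/
theorem tendsto_mean_periodic {E : Type*} [NormedAddCommGroup E] [NormedSpace ℝ E]
    {N : Set ℕ} {Q : ℕ} (hQ : 1 ≤ Q) {f : ℕ → ℝ} (hf : ∀ b, HasResidueDensity N Q b (f b))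
    {h : ℕ → E} (hh : ∀ m n, m % Q = n % Q → h m = h n) :
    Tendsto (fun x : ℕ => (x : ℝ)⁻¹ • ∑ n ∈ (Finset.Icc 1 x).filter (fun n => n ∈ N), h n) atTop
      (nhds (∑ b ∈ Finset.Icc 1 Q, f b • h b)) := by
  have key : ∀ x : ℕ, (x : ℝ)⁻¹ • ∑ n ∈ (Finset.Icc 1 x).filter (fun n => n ∈ N), h n =
      ∑ b ∈ Finset.Icc 1 Q,
        ((((Finset.Icc 1 x).filter (fun n => n ∈ N ∧ n % Q = b % Q)).card : ℝ) / x) • h b := by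
    intro x
    have hmaps : ∀ n ∈ (Finset.Icc 1 x).filter (fun n => n ∈ N),
        (if n % Q = 0 then Q else n % Q) ∈ Finset.Icc 1 Q := by
      intro n _
      have := Nat.mod_lt n hQ
      rw [Finset.mem_Icc]
      split_ifs <;> omega
    rw [← Finset.sum_fiberwise_of_maps_to hmaps, Finset.smul_sum]
    refine Finset.sum_congr rfl fun b hb => ?_
    rw [Finset.mem_Icc] at hb
    have hiff : ∀ n, (if n % Q = 0 then Q else n % Q) = b ↔ n % Q = b % Q := by
      intro n
      have := Nat.mod_lt n hQ
      rcases hb.2.eq_or_lt with rfl | hlt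
      · rw [Nat.mod_self]; split_ifs <;> omega
      · rw [Nat.mod_eq_of_lt hlt]; split_ifs <;> omega
    simp only [hiff, Finset.filter_filter]
    rw [Finset.sum_congr rfl (g := fun _ => h b)
      (fun n hn => hh n b (Finset.mem_filter.1 hn).2.2), Finset.sum_const, ← Nat.cast_smul_eq_nsmul ℝ,
      smul_smul, div_eq_inv_mul]
  simp only [key]
  exact tendsto_finsetSum _ fun b _ => (hf b).smul_const _

theorem HasResidueDensity.nonneg {N : Set ℕ} {q a : ℕ} {d : ℝ} (h : HasResidueDensity N q a d) :
    0 ≤ d :=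
  ge_of_tendsto' h fun _ => by positivity

theorem HasResidueDensity.le_inv {N : Set ℕ} {q a : ℕ} {d : ℝ} (hq : 1 ≤ q)
    (h : HasResidueDensity N q a d) : d ≤ 1 / q := by
  refine le_of_tendsto_of_tendsto' h (hasResidueDensity_univ hq a) fun x => ?_
  gcongr
  simp

/-- The total density is the sum of the densities in residue classes. -/
theorem HasDensity.eq_sum {N : Set ℕ} {ρ : ℝ} (hN : HasDensity N ρ) {Q : ℕ} (hQ : 1 ≤ Q)
    {f : ℕ → ℝ} (hf : ∀ b, HasResidueDensity N Q b (f b)) :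
    ρ = ∑ b ∈ Finset.Icc 1 Q, f b := by
  have h := tendsto_mean_periodic hQ hf (h := fun _ => (1 : ℝ)) (fun _ _ _ => rfl)
  simp only [Finset.sum_const, nsmul_eq_mul, mul_one, smul_eq_mul, ← div_eq_inv_mul] at h
  exact tendsto_nhds_unique hN h

/-- The density of the symmetric difference of `N` with a periodic set. -/
theorem hasDensity_symmDiff {N P : Set ℕ} {Q : ℕ} (hQ : 1 ≤ Q) {f : ℕ → ℝ}
    (hf : ∀ b, HasResidueDensity N Q b (f b)) (hP : ∀ m n, m % Q = n % Q → (m ∈ P ↔ n ∈ P)) :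
    HasDensity (symmDiff N P)
      (∑ b ∈ Finset.Icc 1 Q, if b ∈ P then 1 / (Q : ℝ) - f b else f b) := by
  have h1 := tendsto_mean_periodic hQ hf (h := fun n => if n ∈ P then (-1 : ℝ) else 1)
    (fun m n hmn => by simp only [hP m n hmn])
  have h2 := tendsto_mean_periodic hQ (hasResidueDensity_univ hQ)
    (h := fun n => if n ∈ P then (1 : ℝ) else 0) (fun m n hmn => by simp only [hP m n hmn])
  have h3 := h1.add h2
  rw [← Finset.sum_add_distrib] at h3
  unfold HasDensity
  convert h3 using 1
  · funext x
    rw [← smul_add, smul_eq_mul, ← div_eq_inv_mul]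
    congr 1
    simp only [Finset.sum_filter, ← Finset.sum_add_distrib, Finset.card_filter, Nat.cast_sum]
    refine Finset.sum_congr rfl fun n _ => ?_
    by_cases hn : n ∈ N <;> by_cases hp : n ∈ P <;> simp [Set.mem_symmDiff, hn, hp]
  · congr 1
    refine Finset.sum_congr rfl fun b _ => ?_
    split_ifs <;> simp; ring

theorem hasDensity_of_periodic {P : Set ℕ} {Q : ℕ} (hQ : 1 ≤ Q)
    (hP : ∀ m n, m % Q = n % Q → (m ∈ P ↔ n ∈ P)) : ∃ p, HasDensity P p := by
  have h : ∀ b, HasResidueDensity ∅ Q b 0 := fun b => by simp [HasResidueDensity]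
  have := hasDensity_symmDiff hQ h hP
  exact ⟨_, by simpa [← Set.bot_eq_empty, bot_symmDiff] using this⟩

/-- `N` can be approximated, up to sets of arbitrarily small upper density, by periodic sets. -/
def PeriodicApprox (N : Set ℕ) : Prop :=
  ∀ ε : ℝ, 0 < ε → ∃ Q : ℕ, 1 ≤ Q ∧ ∃ P : Set ℕ, (∀ m n, m % Q = n % Q → (m ∈ P ↔ n ∈ P)) ∧
    ∀ᶠ x : ℕ in atTop,
      (((Finset.Icc 1 x).filter (fun n => n ∈ symmDiff N P)).card : ℝ) / x ≤ ε

theorem periodicApprox_residueClass {q : ℕ} (hq : 1 ≤ q) (a : ℕ) :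
    PeriodicApprox {n | n % q = a % q} := by
  intro ε hε
  refine ⟨q, hq, {n | n % q = a % q}, fun m n h => by simp [h], ?_⟩
  simp [symmDiff_self, hε.le]

theorem PeriodicApprox.inter {N₁ N₂ : Set ℕ} (h₁ : PeriodicApprox N₁) (h₂ : PeriodicApprox N₂) :
    PeriodicApprox (N₁ ∩ N₂) := by
  intro ε hε
  obtain ⟨Q₁, hQ₁, P₁, hP₁, hx₁⟩ := h₁ (ε / 2) (by positivity)
  obtain ⟨Q₂, hQ₂, P₂, hP₂, hx₂⟩ := h₂ (ε / 2) (by positivity)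
  refine ⟨Q₁ * Q₂, Nat.mul_pos hQ₁ hQ₂, P₁ ∩ P₂, fun m n h => ?_, ?_⟩
  · have e1 : m % Q₁ = n % Q₁ := Nat.ModEq.of_mul_right Q₂ h
    have e2 : m % Q₂ = n % Q₂ := Nat.ModEq.of_mul_left Q₁ h
    simp only [Set.mem_inter_iff, hP₁ m n e1, hP₂ m n e2]
  · filter_upwards [hx₁, hx₂] with x h1 h2
    have hsub : (Finset.Icc 1 x).filter (fun n => n ∈ symmDiff (N₁ ∩ N₂) (P₁ ∩ P₂)) ⊆
        (Finset.Icc 1 x).filter (fun n => n ∈ symmDiff N₁ P₁) ∪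
        (Finset.Icc 1 x).filter (fun n => n ∈ symmDiff N₂ P₂) := by
      intro n
      simp only [Finset.mem_filter, Finset.mem_union, Set.mem_symmDiff, Set.mem_inter_iff]
      tauto
    have hc : (((Finset.Icc 1 x).filter
        (fun n => n ∈ symmDiff (N₁ ∩ N₂) (P₁ ∩ P₂))).card : ℝ) ≤
        ((Finset.Icc 1 x).filter (fun n => n ∈ symmDiff N₁ P₁)).card +
        ((Finset.Icc 1 x).filter (fun n => n ∈ symmDiff N₂ P₂)).card := by
      exact_mod_cast (Finset.card_le_card hsub).trans (Finset.card_union_le _ _)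
    calc _ ≤ (((Finset.Icc 1 x).filter (fun n => n ∈ symmDiff N₁ P₁)).card +
        ((Finset.Icc 1 x).filter (fun n => n ∈ symmDiff N₂ P₂)).card : ℝ) / x := by gcongr
      _ ≤ ε := by rw [add_div]; linarith

theorem abs_card_sub_card_le (s : Finset ℕ) (N P : Set ℕ) :
    |((s.filter (fun n => n ∈ N)).card : ℝ) - (s.filter (fun n => n ∈ P)).card| ≤
      (s.filter (fun n => n ∈ symmDiff N P)).card := by
  simp only [Finset.card_filter, Nat.cast_sum, ← Finset.sum_sub_distrib]
  refine (Finset.abs_sum_le_sum_abs _ _).trans (Finset.sum_le_sum fun n _ => ?_)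
  by_cases hn : n ∈ N <;> by_cases hp : n ∈ P <;> simp [Set.mem_symmDiff, hn, hp]

theorem PeriodicApprox.exists_hasDensity {N : Set ℕ} (h : PeriodicApprox N) :
    ∃ d, HasDensity N d := by
  unfold HasDensity
  refine cauchySeq_tendsto_of_complete (Metric.cauchySeq_iff'.2 fun ε hε => ?_)
  obtain ⟨Q, hQ, P, hP, hx⟩ := h (ε / 8) (by positivity)
  obtain ⟨p, hp⟩ := hasDensity_of_periodic hQ hP
  have hp' := (Metric.tendsto_nhds.1 hp) (ε / 8) (by positivity)
  obtain ⟨X, hX⟩ := eventually_atTop.1 ((hx.and hp').and (eventually_gt_atTop 0))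
  have key : ∀ x ≥ X,
      |(((Finset.Icc 1 x).filter (fun n => n ∈ N)).card : ℝ) / x - p| ≤ ε / 4 := by
    intro x hxX
    obtain ⟨⟨h1, h2⟩, h3⟩ := hX x hxX
    have hx0 : (0 : ℝ) < x := by exact_mod_cast h3
    have h4 := div_le_div_of_nonneg_right (abs_card_sub_card_le (Finset.Icc 1 x) N P) hx0.le
    rw [← abs_of_pos hx0, ← abs_div, abs_of_pos hx0, sub_div] at h4
    rw [Real.dist_eq] at h2
    have := abs_sub_le ((((Finset.Icc 1 x).filter (fun n => n ∈ N)).card : ℝ) / x)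
      ((((Finset.Icc 1 x).filter (fun n => n ∈ P)).card : ℝ) / x) p
    linarith
  refine ⟨X, fun n hn => ?_⟩
  rw [Real.dist_eq]
  have h1 := abs_le.1 (key n hn)
  have h2 := abs_le.1 (key X le_rfl)
  rw [abs_lt]
  constructor <;> linarith

theorem PeriodicApprox.exists_hasResidueDensity {N : Set ℕ} (h : PeriodicApprox N) {q : ℕ}
    (hq : 1 ≤ q) (a : ℕ) : ∃ d, HasResidueDensity N q a d := by
  obtain ⟨d, hd⟩ := (h.inter (periodicApprox_residueClass hq a)).exists_hasDensity
  refine ⟨d, ?_⟩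
  unfold HasDensity at hd
  unfold HasResidueDensity
  convert! hd

theorem e_add (s t : ℝ) : e (s + t) = e s * e t := by
  simp only [e, ← Complex.exp_add]
  congr 1
  push_cast
  ring

theorem e_nat_mul (n : ℕ) (t : ℝ) : e (n * t) = e t ^ n := by
  simp only [e, ← Complex.exp_nat_mul]
  congr 1
  push_cast
  ring

theorem e_eq_one_iff (t : ℝ) : e t = 1 ↔ ∃ n : ℤ, t = n := by
  rw [e, Complex.exp_eq_one_iff]
  refine exists_congr fun n => ?_
  rw [mul_comm, mul_left_inj' Complex.two_pi_I_ne_zero]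
  norm_cast

theorem e_conj (t : ℝ) : (starRingEnd ℂ) (e t) = e (-t) := by
  rw [e, e, ← Complex.exp_conj]
  congr 1
  simp [map_ofNat (starRingEnd ℂ) 2]

theorem e_mul_div_of_mod_eq {Q m n : ℕ} (hQ : 1 ≤ Q) (a : ℕ) (h : m % Q = n % Q) :
    e ((a : ℝ) * m / Q) = e ((a : ℝ) * n / Q) := by
  have hQ0 : (Q : ℝ) ≠ 0 := by positivity
  obtain ⟨k, hk⟩ := (Nat.modEq_iff_dvd.1 (show n ≡ m [MOD Q] from h.symm))
  have hk' : (m : ℝ) = n + Q * k := by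
    have : (m : ℤ) = n + Q * k := by omega
    exact_mod_cast this
  have h1 : (a : ℝ) * m / Q = a * n / Q + ((a * k : ℤ) : ℝ) := by
    rw [hk']; push_cast; field_simp
  rw [h1, e_add, (e_eq_one_iff _).2 ⟨_, rfl⟩, mul_one]

theorem sum_e_mul_div {Q b c : ℕ} (hb : b ∈ Finset.Icc 1 Q) (hc : c ∈ Finset.Icc 1 Q) :
    ∑ a ∈ Finset.Icc 1 Q, e ((a : ℝ) * (((b : ℝ) - c) / Q)) = if b = c then (Q : ℂ) else 0 := by
  rw [Finset.mem_Icc] at hb hc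
  have hQ0 : (Q : ℝ) ≠ 0 := by
    have : Q ≠ 0 := by omega
    exact_mod_cast this
  simp only [e_nat_mul]
  split_ifs with h
  · subst h
    simp [(e_eq_one_iff 0).2 ⟨0, by simp⟩]
  · set ζ := e (((b : ℝ) - c) / Q) with hζ
    have h1 : ζ ≠ 1 := by
      rw [hζ, Ne, e_eq_one_iff]
      rintro ⟨n, hn⟩
      rw [div_eq_iff hQ0] at hn
      have hn' : (b : ℤ) - c = n * Q := by exact_mod_cast hn
      have h2 : (b : ℤ) - c ≠ 0 := by omega
      have h3 : |(b : ℤ) - c| < Q := by rw [abs_lt]; omega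
      exact h2 (Int.eq_zero_of_abs_lt_dvd ⟨n, by rw [hn', mul_comm]⟩ h3)
    have h2 : ζ ^ Q = 1 := by
      rw [hζ, ← e_nat_mul, e_eq_one_iff]
      exact ⟨(b : ℤ) - c, by push_cast; field_simp⟩
    have h3 : ∑ a ∈ Finset.Icc 1 Q, ζ ^ a = ∑ a ∈ Finset.range Q, ζ ^ (a + 1) := by
      rw [Finset.range_eq_Ico, Finset.sum_Ico_add' (fun a => ζ ^ a) 0 Q 1]
      rfl
    simp only [h3, pow_succ, ← Finset.sum_mul, geom_sum_eq h1, h2, sub_self, zero_div, zero_mul]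

/-- Parseval's identity modulo `Q`. -/
theorem sum_norm_sq_fourier (Q : ℕ) (f : ℕ → ℝ) :
    ∑ a ∈ Finset.Icc 1 Q, ‖∑ b ∈ Finset.Icc 1 Q, (f b : ℂ) * e ((a : ℝ) * b / Q)‖ ^ 2 =
      Q * ∑ b ∈ Finset.Icc 1 Q, f b ^ 2 := by
  have h : ∀ a : ℕ, (((‖∑ b ∈ Finset.Icc 1 Q, (f b : ℂ) * e ((a : ℝ) * b / Q)‖ ^ 2 : ℝ)) : ℂ) =
      ∑ b ∈ Finset.Icc 1 Q, ∑ c ∈ Finset.Icc 1 Q,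
        (f b : ℂ) * f c * e ((a : ℝ) * (((b : ℝ) - c) / Q)) := by
    intro a
    rw [Complex.ofReal_pow, ← Complex.mul_conj', map_sum, Finset.sum_mul_sum]
    refine Finset.sum_congr rfl fun b _ => Finset.sum_congr rfl fun c _ => ?_
    rw [map_mul, Complex.conj_ofReal, e_conj, mul_mul_mul_comm, ← e_add]
    congr 2
    ring
  apply Complex.ofReal_injective
  rw [Complex.ofReal_sum, Finset.sum_congr rfl fun a _ => h a, Finset.sum_comm]
  push_cast
  rw [Finset.mul_sum]
  refine Finset.sum_congr rfl fun b hb => ?_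
  rw [Finset.sum_comm, Finset.sum_congr rfl fun c hc => by
    rw [← Finset.mul_sum, sum_e_mul_div hb hc]]
  simp only [mul_ite, mul_zero, Finset.sum_ite_eq, hb, if_true]
  ring

/-- Summing over fractions with denominator `Q` amounts to summing over reduced fractions with
denominator dividing `Q`. -/
theorem sum_reduced_fractions {Q : ℕ} (hQ : 1 ≤ Q) (g : ℝ → ℝ) :
    ∑ q ∈ Q.divisors, ∑ a ∈ (Finset.Icc 1 q).filter (fun a => Nat.Coprime a q), g ((a : ℝ) / q) =
      ∑ a ∈ Finset.Icc 1 Q, g ((a : ℝ) / Q) := by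
  have hmaps : ∀ a ∈ Finset.Icc 1 Q, Q / a.gcd Q ∈ Q.divisors := fun a _ =>
    Nat.mem_divisors.2 ⟨Nat.div_dvd_of_dvd (Nat.gcd_dvd_right a Q), by omega⟩
  rw [← Finset.sum_fiberwise_of_maps_to hmaps]
  refine Finset.sum_congr rfl fun q hq => ?_
  obtain ⟨d, rfl⟩ := (Nat.mem_divisors.1 hq).1
  have hq0 : 0 < q := Nat.pos_of_ne_zero fun h => by simp [h] at hQ
  have hd0 : 0 < d := Nat.pos_of_ne_zero fun h => by simp [h] at hQ
  refine Finset.sum_bij (fun a _ => a * d) ?_ ?_ ?_ ?_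
  · intro a ha
    simp only [Finset.mem_filter, Finset.mem_Icc] at ha ⊢
    refine ⟨⟨Nat.mul_pos ha.1.1 hd0, Nat.mul_le_mul_right d ha.1.2⟩, ?_⟩
    rw [Nat.gcd_mul_right, ha.2, one_mul, Nat.mul_div_cancel _ hd0]
  · intro a _ b _ h
    exact Nat.eq_of_mul_eq_mul_right hd0 h
  · intro c hc
    simp only [Finset.mem_filter, Finset.mem_Icc] at hc
    have hg : c.gcd (q * d) = d := by
      have h1 := Nat.div_mul_cancel (Nat.gcd_dvd_right c (q * d))
      rw [hc.2] at h1
      exact Nat.eq_of_mul_eq_mul_left hq0 h1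
    obtain ⟨a, rfl⟩ : d ∣ c := hg ▸ Nat.gcd_dvd_left c (q * d)
    rw [mul_comm d a] at hc hg
    refine ⟨a, ?_, mul_comm a d⟩
    simp only [Finset.mem_filter, Finset.mem_Icc]
    refine ⟨⟨Nat.pos_of_mul_pos_right hc.1.1, Nat.le_of_mul_le_mul_right hc.1.2 hd0⟩, ?_⟩
    rw [Nat.gcd_mul_right] at hg
    exact Nat.eq_of_mul_eq_mul_right hd0 (by rw [hg, one_mul])
  · intro a _
    congr 1
    have : (d : ℝ) ≠ 0 := by positivity
    push_cast
    rw [mul_div_mul_right _ _ this]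

/-- The `q`-th term of the unnormalised singular series. -/
noncomputable def seriesTerm (F : ℕ → ℕ → ℝ) (q : ℕ) : ℝ :=
  ∑ a ∈ (Finset.Icc 1 q).filter (fun a => Nat.Coprime a q),
    ‖∑ b ∈ Finset.Icc 1 q, (F q b : ℂ) * e ((a : ℝ) * b / q)‖ ^ 2

theorem seriesTerm_nonneg (F : ℕ → ℕ → ℝ) (q : ℕ) : 0 ≤ seriesTerm F q :=
  Finset.sum_nonneg fun _ _ => by positivity

theorem extremalSum_eq (F : ℕ → ℕ → ℝ) (ρ : ℝ) :
    extremalSum F ρ = (∑' q, seriesTerm F q) / ρ ^ 2 := by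
  rw [extremalSum, ← tsum_div_const]
  congr 1
  funext q
  rw [seriesTerm, Finset.sum_div]
  refine Finset.sum_congr rfl fun a _ => ?_
  have : ∑ b ∈ Finset.Icc 1 q, ((F q b / ρ : ℝ) : ℂ) * e ((a : ℝ) * b / q) =
      (∑ b ∈ Finset.Icc 1 q, (F q b : ℂ) * e ((a : ℝ) * b / q)) / (ρ : ℂ) := by
    rw [Finset.sum_div]
    refine Finset.sum_congr rfl fun b _ => ?_
    push_cast
    ring
  rw [this, norm_div, div_pow, Complex.norm_real, Real.norm_eq_abs, sq_abs]

theorem tendsto_mean_e {N : Set ℕ} {Q : ℕ} (hQ : 1 ≤ Q) {f : ℕ → ℝ}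
    (hf : ∀ b, HasResidueDensity N Q b (f b)) (a : ℕ) :
    Tendsto (fun x : ℕ => (x : ℝ)⁻¹ •
        ∑ n ∈ (Finset.Icc 1 x).filter (fun n => n ∈ N), e ((a : ℝ) / Q * n)) atTop
      (nhds (∑ b ∈ Finset.Icc 1 Q, (f b : ℂ) * e ((a : ℝ) * b / Q))) := by
  have h := tendsto_mean_periodic hQ hf (h := fun n => e ((a : ℝ) * n / Q))
    (fun m n hmn => e_mul_div_of_mod_eq hQ a hmn)
  simpa only [Complex.real_smul, mul_div_right_comm] using h

/-- The partial sum of the singular series over the divisors of `Q`. -/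
theorem sum_divisors_seriesTerm {N : Set ℕ} {F : ℕ → ℕ → ℝ}
    (hF : ∀ q, 1 ≤ q → ∀ a, HasResidueDensity N q a (F q a)) {Q : ℕ} (hQ : 1 ≤ Q) :
    ∑ q ∈ Q.divisors, seriesTerm F q = Q * ∑ b ∈ Finset.Icc 1 Q, F Q b ^ 2 := by
  obtain ⟨g, key⟩ : ∃ g : ℝ → ℝ, ∀ q, 1 ≤ q → ∀ a : ℕ,
      ‖∑ b ∈ Finset.Icc 1 q, (F q b : ℂ) * e ((a : ℝ) * b / q)‖ ^ 2 = g ((a : ℝ) / q) :=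
    ⟨fun θ => ‖limUnder atTop (fun x : ℕ => (x : ℝ)⁻¹ •
      ∑ n ∈ (Finset.Icc 1 x).filter (fun n => n ∈ N), e (θ * n))‖ ^ 2,
      fun q hq a => by rw [← (tendsto_mean_e hq (hF q hq) a).limUnder_eq]⟩
  rw [← sum_norm_sq_fourier, Finset.sum_congr rfl fun a _ => key Q hQ a,
    ← sum_reduced_fractions hQ]
  exact Finset.sum_congr rfl fun q hq =>
    Finset.sum_congr rfl fun a _ => key q (Nat.pos_of_mem_divisors hq) a

theorem exists_sum_le_sum_divisors (F : ℕ → ℕ → ℝ) (s : Finset ℕ) :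
    ∃ Q : ℕ, 1 ≤ Q ∧ ∑ q ∈ s, seriesTerm F q ≤ ∑ q ∈ Q.divisors, seriesTerm F q := by
  have hpos : ∏ q ∈ s.erase 0, q ≠ 0 :=
    Finset.prod_ne_zero_iff.2 fun q hq => (Finset.mem_erase.1 hq).1
  refine ⟨∏ q ∈ s.erase 0, q, Nat.one_le_iff_ne_zero.2 hpos, ?_⟩
  rw [← Finset.sum_erase s (show seriesTerm F 0 = 0 by simp [seriesTerm])]
  exact Finset.sum_le_sum_of_subset_of_nonneg
    (fun q hq => Nat.mem_divisors.2 ⟨Finset.dvd_prod_of_mem _ hq, hpos⟩)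
    fun q _ _ => seriesTerm_nonneg F q

theorem Extremal.periodicApprox {N : Set ℕ} (h : Extremal N) : PeriodicApprox N := by
  obtain ⟨ρ, hρ, hN, F, hF, hsum⟩ := h
  have hS : ∑' q, seriesTerm F q = ρ := by
    rw [extremalSum_eq] at hsum
    field_simp at hsum
    linarith
  have hsummable : Summable (seriesTerm F) := by
    by_contra hns
    rw [tsum_eq_zero_of_not_summable hns] at hS
    linarith
  intro ε hε
  have hlim := hsummable.hasSum
  rw [hS] at hlim
  obtain ⟨s, hs⟩ := (hlim.eventually (lt_mem_nhds (show ρ - ε / 4 < ρ by linarith))).exists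
  obtain ⟨Q, hQ, hsQ⟩ := exists_sum_le_sum_divisors F s
  rw [sum_divisors_seriesTerm hF hQ] at hsQ
  have hQ0 : (0 : ℝ) < Q := by exact_mod_cast hQ
  have hmod : ∀ m n, m % Q = n % Q → F Q m = F Q n := by
    intro m n hmn
    have h1 := hF Q hQ m
    rw [HasResidueDensity, hmn] at h1
    exact tendsto_nhds_unique h1 (hF Q hQ n)
  obtain ⟨P, hmem⟩ : ∃ P : Set ℕ, ∀ n, n ∈ P ↔ 1 ≤ 2 * (Q * F Q n) := ⟨{n | _}, fun _ => Iff.rfl⟩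
  have hP : ∀ m n, m % Q = n % Q → (m ∈ P ↔ n ∈ P) := fun m n hmn => by
    rw [hmem, hmem, hmod m n hmn]
  refine ⟨Q, hQ, P, hP, ?_⟩
  have hd := hasDensity_symmDiff hQ (hF Q hQ) hP
  refine (hd.eventually (gt_mem_nhds (show _ < ε from ?_))).mono fun x hx => hx.le
  have hρsum := hN.eq_sum hQ (hF Q hQ)
  have hbound : ∀ b, (if b ∈ P then 1 / (Q : ℝ) - F Q b else F Q b) ≤
      2 * (F Q b - Q * F Q b ^ 2) := by
    intro b
    have h0 := (hF Q hQ b).nonneg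
    have h1 := (hF Q hQ b).le_inv hQ
    split_ifs with hb <;> rw [hmem] at hb
    · have : 2 * (F Q b - Q * F Q b ^ 2) = 2 * (Q * F Q b) * (1 / Q - F Q b) := by field_simp
      rw [this]
      nlinarith
    · nlinarith [mul_nonneg h0 (show 0 ≤ 1 - 2 * (Q * F Q b) by linarith)]
  calc _ ≤ ∑ b ∈ Finset.Icc 1 Q, 2 * (F Q b - Q * F Q b ^ 2) :=
        Finset.sum_le_sum fun b _ => hbound b
    _ = 2 * (ρ - Q * ∑ b ∈ Finset.Icc 1 Q, F Q b ^ 2) := by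
        rw [← Finset.mul_sum, Finset.sum_sub_distrib, ← hρsum, ← Finset.mul_sum]
    _ < ε := by linarith

theorem PeriodicApprox.extremal {N : Set ℕ} (h : PeriodicApprox N) {ρ : ℝ} (hρ : 0 < ρ)
    (hN : HasDensity N ρ) : Extremal N := by
  choose! F hF using fun q (hq : 1 ≤ q) a => h.exists_hasResidueDensity hq a
  refine ⟨ρ, hρ, hN, F, hF, ?_⟩
  have hle : ∀ s : Finset ℕ, ∑ q ∈ s, seriesTerm F q ≤ ρ := by
    intro s
    obtain ⟨Q, hQ, hsQ⟩ := exists_sum_le_sum_divisors F s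
    refine hsQ.trans ?_
    have hQ0 : (0 : ℝ) < Q := by exact_mod_cast hQ
    rw [sum_divisors_seriesTerm hF hQ, hN.eq_sum hQ (hF Q hQ), Finset.mul_sum]
    refine Finset.sum_le_sum fun b _ => ?_
    have h0 := (hF Q hQ b).nonneg
    have h1 := (hF Q hQ b).le_inv hQ
    rw [le_div_iff₀ hQ0] at h1
    nlinarith
  have hsummable : Summable (seriesTerm F) := summable_of_sum_le (seriesTerm_nonneg F) hle
  have hS : ∑' q, seriesTerm F q = ρ := by
    refine le_antisymm (hsummable.tsum_le_of_sum_le hle) (le_of_forall_pos_le_add fun ε hε => ?_)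
    obtain ⟨Q, hQ, P, hP, hx⟩ := h ε hε
    have hQ0 : (0 : ℝ) < Q := by exact_mod_cast hQ
    have hd := le_of_tendsto (hasDensity_symmDiff hQ (hF Q hQ) hP) hx
    have hpart := hsummable.sum_le_tsum Q.divisors fun q _ => seriesTerm_nonneg F q
    rw [sum_divisors_seriesTerm hF hQ] at hpart
    have hρsum := hN.eq_sum hQ (hF Q hQ)
    have hbound : ∀ b, F Q b - Q * F Q b ^ 2 ≤ if b ∈ P then 1 / (Q : ℝ) - F Q b else F Q b := by
      intro b
      have h0 := (hF Q hQ b).nonneg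
      have h1 := (hF Q hQ b).le_inv hQ
      have h2 := h1
      rw [le_div_iff₀ hQ0] at h2
      split_ifs with hb
      · have : F Q b - Q * F Q b ^ 2 = F Q b * Q * (1 / Q - F Q b) := by field_simp
        rw [this]
        nlinarith
      · nlinarith [mul_nonneg hQ0.le (sq_nonneg (F Q b))]
    have hall := (Finset.sum_le_sum fun b (_ : b ∈ Finset.Icc 1 Q) => hbound b).trans hd
    rw [Finset.sum_sub_distrib, ← hρsum, ← Finset.mul_sum] at hall
    linarith
  rw [extremalSum_eq, hS]
  field_simp

/-- the intersection of extremal sets, if of positive density, is extremal. -/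
theorem stmt_2 (N₁ N₂ : Set ℕ) (h₁ : Extremal N₁) (h₂ : Extremal N₂)
    (hd : ∃ ρ : ℝ, 0 < ρ ∧ HasDensity (N₁ ∩ N₂) ρ) :
    Extremal (N₁ ∩ N₂) := by
  obtain ⟨ρ, hρ, hN⟩ := hd
  exact (h₁.periodicApprox.inter h₂.periodicApprox).extremal hρ hN
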